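/- Let λ be a measure as in the context with λ(ℝ) = ∞ and support contained in (−r₀, r₀) for some r₀ > 0. Let g ∈ C¹(ℝ) with g(0) = 0 and g'(0) < 0, and suppose there are 0 < θ < γ with g(θ) = g(γ) = 0, g < 0 on (0,θ) and g > 0 on (θ,γ). Let (ε_n) be a sequence of positive numbers tending to 0 and let λ_n be the restriction of λ to {z : |z| > ε_n}. Suppose that for each n there exist c_n > 0 and m_n ∈ C²(ℝ), monotone nonincreasing with 0 ≤ m_n ≤ γ, such that −c_n m_n'(x) = ∫_ℝ (m_n(x+z) − m_n(x)) dλ_n(z) + g(m_n(x)) for every x ∈ ℝ, lim_{x→−∞} m_n(x) = γ, lim_{x→+∞} m_n(x) = 0, and that c_n → 0 as n → ∞. Then there exists a continuous, positive, monotone nonincreasing function m̄ : ℝ → ℝ with lim_{x→−∞} m̄(x) = γ and lim_{x→+∞} m̄(x) = 0, such that for almost every x ∈ ℝ the principal value D_λ m̄(x) exists and D_λ m̄(x) + g(m̄(x)) = 0. -/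

import Mathlib

open MeasureTheory Filter Topology Set

/-- Truncated nonlocal operator `D_{μ,δ} u (x) = ∫_{|z| ≥ δ} (u(x+z) − u(x)) dμ(z)`. -/
noncomputable def Dtrunc (μ : Measure ℝ) (u : ℝ → ℝ) (δ : ℝ) (x : ℝ) : ℝ :=
  ∫ z in {z : ℝ | δ ≤ |z|}, (u (x + z) - u x) ∂μ

/-- The principal value `D_μ u (x)` exists and equals `L`. -/
def HasPV (μ : Measure ℝ) (u : ℝ → ℝ) (x : ℝ) (L : ℝ) : Prop :=
  Tendsto (fun δ => Dtrunc μ u δ x) (𝓝[>] (0 : ℝ)) (𝓝 L)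

/-- A symmetric diffuse Lévy measure as in the paper. -/
structure LevyMeasure (μ : Measure ℝ) : Prop where
  symm : Measure.map (fun z : ℝ => -z) μ = μ
  moment : ∫⁻ z, ENNReal.ofReal (min 1 (z ^ 2)) ∂μ < ⊤
  diffuse : ∀ x : ℝ, x ≠ 0 → μ {x} = 0

/-- A bistable nonlinearity with threshold `θ`. -/
structure Bistable (f : ℝ → ℝ) (θ : ℝ) : Prop where
  smooth : ContDiff ℝ 1 f
  f0 : f 0 = 0
  f1 : f 1 = 0
  df1 : deriv f 1 < 0
  θ_mem : θ ∈ Set.Ioo (0 : ℝ) 1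
  df0 : deriv f 0 < 0
  neg : ∀ s ∈ Set.Ioo (0 : ℝ) θ, f s < 0
  fθ : f θ = 0
  pos : ∀ s ∈ Set.Ioo θ (1 : ℝ), 0 < f s
  dfθ : 0 < deriv f θ

/-- An ignition nonlinearity with threshold `θ`. -/
structure Ignition (f : ℝ → ℝ) (θ : ℝ) : Prop where
  smooth : ContDiff ℝ 1 f
  f1 : f 1 = 0
  df1 : deriv f 1 < 0
  θ_mem : θ ∈ Set.Ioo (0 : ℝ) 1
  zero : ∀ s ∈ Set.Icc (0 : ℝ) θ, f s = 0
  pos : ∀ s ∈ Set.Ioo θ (1 : ℝ), 0 < f s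

/-- A monostable nonlinearity. -/
structure Monostable (f : ℝ → ℝ) : Prop where
  smooth : ContDiff ℝ 1 f
  f0 : f 0 = 0
  f1 : f 1 = 0
  df1 : deriv f 1 < 0
  pos : ∀ s ∈ Set.Ioo (0 : ℝ) 1, 0 < f s



/-- A C¹ monotone front profile from `γ` to `0`, with `p = -m'`. -/
structure FrontProf (m p : ℝ → ℝ) (γ : ℝ) : Prop where
  hd : ∀ x, HasDerivAt m (-(p x)) x
  hp : Continuous p
  anti : Antitone m
  bd : ∀ x, m x ∈ Set.Icc 0 γ
  bot : Tendsto m atBot (𝓝 γ)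
  top : Tendsto m atTop (𝓝 (0 : ℝ))

namespace FrontProf

variable {m p : ℝ → ℝ} {γ : ℝ}

theorem cont (F : FrontProf m p γ) : Continuous m :=
  continuous_iff_continuousAt.2 fun x => (F.hd x).continuousAt

theorem hdn (F : FrontProf m p γ) (x : ℝ) : HasDerivAt (fun x => -(m x)) (p x) x := by
  have := (F.hd x).neg
  rw [neg_neg] at this
  exact this

theorem γnn (F : FrontProf m p γ) : 0 ≤ γ := (F.bd 0).1.trans (F.bd 0).2

theorem pnn (F : FrontProf m p γ) (x : ℝ) : 0 ≤ p x := by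
  have h2 := F.anti.deriv_nonpos (x := x)
  rw [(F.hd x).deriv] at h2
  linarith

theorem intP (F : FrontProf m p γ) : Integrable p := by
  refine integrable_of_intervalIntegral_norm_bounded (l := atTop) (a := fun i : ℝ => -i)
    (b := fun i => i) γ (fun i => ?_) tendsto_neg_atTop_atBot tendsto_id ?_
  · exact (F.hp.integrableOn_Icc).mono_set Ioc_subset_Icc_self
  · filter_upwards with i
    have h1 : ∀ x, ‖p x‖ = p x := fun x => Real.norm_of_nonneg (F.pnn x)
    simp_rw [h1]
    have h2 := intervalIntegral.integral_eq_sub_of_hasDerivAt (a := -i) (b := i) (f := fun x => -(m x))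
      (f' := p) (fun x _ => F.hdn x) (F.hp.intervalIntegrable _ _)
    rw [h2]
    have := (F.bd i).1
    have := (F.bd (-i)).2
    linarith

theorem integral_comp (F : FrontProf m p γ) {φ : ℝ → ℝ} (hφ : Continuous φ) :
    Integrable (fun x => φ (m x) * p x) ∧ ∫ x, φ (m x) * p x = ∫ s in (0 : ℝ)..γ, φ s := by
  obtain ⟨B, hB⟩ := (isCompact_Icc (a := (0 : ℝ)) (b := γ)).exists_bound_of_continuousOn
    hφ.continuousOn
  have hI : Integrable (fun x => φ (m x) * p x) :=
    F.intP.bdd_mul (c := B) (hφ.comp F.cont).aestronglyMeasurable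
      (ae_of_all _ fun x => hB _ (F.bd x))
  refine ⟨hI, ?_⟩
  have hG : ∀ s, HasDerivAt (fun s => ∫ t in (0 : ℝ)..s, φ t) (φ s) s := fun s =>
    intervalIntegral.integral_hasDerivAt_right (hφ.intervalIntegrable _ _)
      (hφ.stronglyMeasurableAtFilter _ _) hφ.continuousAt
  have hGc : Continuous (fun s => ∫ t in (0 : ℝ)..s, φ t) :=
    continuous_iff_continuousAt.2 fun x => (hG x).continuousAt
  have := integral_of_hasDerivAt_of_tendsto (f := fun x => -(∫ t in (0 : ℝ)..(m x), φ t))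
    (f' := fun x => φ (m x) * p x) (m := -(∫ t in (0 : ℝ)..γ, φ t))
    (n := -(∫ t in (0 : ℝ)..0, φ t)) (fun x => by
      have := ((hG (m x)).comp x (F.hd x)).neg
      rw [mul_neg, neg_neg] at this
      exact this) hI ((hGc.tendsto γ).comp F.bot).neg ((hGc.tendsto 0).comp F.top).neg
  rw [this]; simp

theorem intP_eq (F : FrontProf m p γ) : ∫ x, p x = γ := by
  have := (F.integral_comp (φ := fun _ => 1) continuous_const).2
  simpa using this

theorem absdiff (F : FrontProf m p γ) (x y : ℝ) : |m x - m y| ≤ γ := by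
  have h1 := F.bd x
  have h2 := F.bd y
  rw [abs_le]; constructor <;> linarith [h1.1, h1.2, h2.1, h2.2]

theorem int_diff (F : FrontProf m p γ) (μ : Measure ℝ) [IsFiniteMeasure μ] (x y : ℝ) :
    Integrable (fun z => m (x + z) - m y) μ := by
  have := F.cont
  refine Integrable.of_bound (C := γ) (by fun_prop : Continuous _).aestronglyMeasurable
    (ae_of_all _ fun z => F.absdiff _ _)

theorem int_m (F : FrontProf m p γ) (μ : Measure ℝ) [IsFiniteMeasure μ] (x : ℝ) :
    Integrable (fun z => m (x + z)) μ := by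
  have := F.cont
  refine Integrable.of_bound (C := γ) (by fun_prop : Continuous _).aestronglyMeasurable
    (ae_of_all _ fun z => ?_)
  rw [Real.norm_of_nonneg (F.bd _).1]; exact (F.bd _).2

/-- Energy identity: the symmetric nonlocal operator is orthogonal to the derivative. -/
theorem energy (F : FrontProf m p γ) (μ : Measure ℝ) [IsFiniteMeasure μ]
    (hs : MeasurePreserving (fun z : ℝ => -z) μ μ) :
    Integrable (fun x => (∫ z, (m (x + z) - m x) ∂μ) * p x) ∧
    ∫ x, (∫ z, (m (x + z) - m x) ∂μ) * p x = 0 := by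
  have hc := F.cont
  have hpc := F.hp
  have hprod : Integrable (fun q : ℝ × ℝ => (m (q.1 + q.2) - m q.1) * p q.1)
      ((volume : Measure ℝ).prod μ) := by
    have h1 : Integrable (fun q : ℝ × ℝ => p q.1) ((volume : Measure ℝ).prod μ) :=
      F.intP.comp_fst μ
    exact h1.bdd_mul (c := γ) (by fun_prop : Continuous _).aestronglyMeasurable
      (ae_of_all _ fun q => F.absdiff _ _)
  have e1 : (fun x => (∫ z, (m (x + z) - m x) ∂μ) * p x) =
      fun x => ∫ z, (m (x + z) - m x) * p x ∂μ := by
    funext x; rw [integral_mul_const]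
  rw [e1]
  refine ⟨hprod.integral_prod_left, ?_⟩
  rw [integral_integral_swap hprod]
  set A : ℝ → ℝ := fun z => ∫ x, (m (x + z) - m x) * p x with hA
  have hshift : ∀ z, Integrable (fun x => m (x + z) * p x) := fun z =>
    F.intP.bdd_mul (c := γ) (by fun_prop : Continuous _).aestronglyMeasurable
      (ae_of_all _ fun x => by rw [Real.norm_of_nonneg (F.bd _).1]; exact (F.bd _).2)
  have hsub : ∀ z, A z = (∫ x, m (x + z) * p x) - γ ^ 2 / 2 := by
    intro z
    have h2 := F.integral_comp (φ := fun s => s) continuous_id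
    simp only [hA, sub_mul]
    rw [integral_sub (hshift z) h2.1, h2.2]; simp
  have hanti : ∀ z, A (-z) = - A z := by
    intro z
    have t1 : ∫ x, m (x + -z) * p x = ∫ x, m x * p (x + z) := by
      rw [← integral_add_right_eq_self (fun x => m (x + -z) * p x) z]; simp
    have i1 : Integrable (fun x => m x * p (x + z)) := by
      have := (hshift (-z)).comp_add_right z
      simpa using this
    have t2 : ∫ x, (m (x + z) * p x + m x * p (x + z)) = γ ^ 2 := by
      have := integral_of_hasDerivAt_of_tendsto (f := fun x => -(m (x + z) * m x))
        (f' := fun x => m (x + z) * p x + m x * p (x + z)) (m := -(γ * γ))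
        (n := -(0 * 0)) (fun x => by
          have h1 : HasDerivAt (fun x => m (x + z)) (-(p (x + z))) x := by
            simpa using (F.hd (x + z)).comp_add_const x z
          have := (h1.mul (F.hd x)).neg
          have e : -(-p (x + z) * m x + m (x + z) * -p x) = m (x + z) * p x + m x * p (x + z) := by
            ring
          rw [e] at this
          exact this) ((hshift z).add i1)
        ((F.bot.comp (tendsto_atBot_add_const_right _ z tendsto_id)).mul F.bot).neg
        ((F.top.comp (tendsto_atTop_add_const_right _ z tendsto_id)).mul F.top).neg
      rw [this]; ring
    rw [integral_add (hshift z) i1] at t2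
    rw [hsub, hsub, t1]; linarith
  have h3 : ∫ z, A (-z) ∂μ = ∫ z, A z ∂μ :=
    hs.integral_comp (Homeomorph.neg ℝ).measurableEmbedding A
  simp_rw [hanti] at h3
  rw [integral_neg] at h3
  linarith

/-- Equicontinuity of the convolution, for a diffuse measure. -/
theorem equi (F : FrontProf m p γ) (μ : Measure ℝ) [IsFiniteMeasure μ] (h η : ℝ) (hh : 0 ≤ h)
    (hη : 0 ≤ η)
    (hω : ∀ a, μ (Icc a (a + h)) ≤ ENNReal.ofReal η) (x : ℝ) :
    ∫ z, (m (x + z) - m (x + z + h)) ∂μ ≤ γ * η := by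
  have hc := F.cont
  have hpc := F.hp
  have hnn : ∀ z, 0 ≤ m (x + z) - m (x + z + h) := fun z => sub_nonneg.2 (F.anti (by linarith))
  rw [integral_eq_lintegral_of_nonneg_ae (ae_of_all _ hnn)
    (by fun_prop : Continuous _).aestronglyMeasurable]
  refine ENNReal.toReal_le_of_le_ofReal (mul_nonneg F.γnn hη) ?_
  have e1 : ∀ z, ENNReal.ofReal (m (x + z) - m (x + z + h)) =
      ∫⁻ u, (Icc (u - x - h) (u - x - h + h)).indicator (fun _ => ENNReal.ofReal (p u)) z := by
    intro z
    have h2 := intervalIntegral.integral_eq_sub_of_hasDerivAt (a := x + z) (b := x + z + h)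
      (f := fun x => -(m x)) (f' := p) (fun x _ => F.hdn x)
      (hpc.intervalIntegrable _ _)
    have h3 : m (x + z) - m (x + z + h) = ∫ u in Icc (x + z) (x + z + h), p u := by
      rw [integral_Icc_eq_integral_Ioc, ← intervalIntegral.integral_of_le (by linarith), h2]; ring
    rw [h3, ofReal_integral_eq_lintegral_ofReal F.intP.integrableOn (ae_of_all _ F.pnn),
      ← lintegral_indicator measurableSet_Icc]
    congr 1
    funext u
    by_cases hu : u ∈ Icc (x + z) (x + z + h)
    · rw [indicator_of_mem hu, indicator_of_mem]
      constructor <;> linarith [hu.1, hu.2]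
    · rw [indicator_of_notMem hu, indicator_of_notMem]
      intro hz; apply hu
      constructor <;> linarith [hz.1, hz.2]
  simp_rw [e1]
  rw [lintegral_lintegral_swap]
  · calc ∫⁻ u, ∫⁻ z, (Icc (u - x - h) (u - x - h + h)).indicator
          (fun _ => ENNReal.ofReal (p u)) z ∂μ
        = ∫⁻ u, ENNReal.ofReal (p u) * μ (Icc (u - x - h) (u - x - h + h)) := by
          congr 1; funext u
          rw [lintegral_indicator_const measurableSet_Icc]
      _ ≤ ∫⁻ u, ENNReal.ofReal (p u) * ENNReal.ofReal η :=
          lintegral_mono fun u => mul_le_mul_right (hω _) _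
      _ = ENNReal.ofReal (γ * η) := by
          rw [lintegral_mul_const _ (by fun_prop), ENNReal.ofReal_mul F.γnn,
            ← ofReal_integral_eq_lintegral_ofReal F.intP (ae_of_all _ F.pnn), F.intP_eq]
  · have : MeasurableSet {q : ℝ × ℝ | q.1 ∈ Icc (q.2 - x - h) (q.2 - x - h + h)} := by
      apply IsClosed.measurableSet
      have c1 : Continuous (fun q : ℝ × ℝ => q.2 - x - h) := by fun_prop
      have c2 : Continuous (fun q : ℝ × ℝ => q.2 - x - h + h) := by fun_prop
      exact (isClosed_le c1 continuous_fst).inter (isClosed_le continuous_fst c2)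
    have h4 : Measurable (fun q : ℝ × ℝ => ENNReal.ofReal (p q.2)) := by fun_prop
    exact (h4.indicator this).aemeasurable

end FrontProf

/-- Uniform smallness of a diffuse finite measure on short intervals. -/
theorem diffuse_unif (μ : Measure ℝ) [IsFiniteMeasure μ] (hat : ∀ x, μ {x} = 0)
    (r₀ : ℝ) (hsupp : μ {z : ℝ | r₀ ≤ |z|} = 0) (η : ℝ) (hη : 0 < η) :
    ∃ h > 0, ∀ a, μ (Icc a (a + h)) ≤ ENNReal.ofReal η := by
  have hU : ∀ x : ℝ, ∃ U : Set ℝ, {x} ⊆ U ∧ IsOpen U ∧ μ U < ENNReal.ofReal η := fun x =>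
    Set.exists_isOpen_lt_of_lt {x} _ (by rw [hat]; exact ENNReal.ofReal_pos.2 hη)
  choose U hxU hUo hUμ using hU
  obtain ⟨δ, hδ, hL⟩ := lebesgue_number_lemma_of_metric
    (isCompact_Icc (a := -r₀ - 1) (b := r₀ + 1)) hUo
    (fun x _ => mem_iUnion.2 ⟨x, hxU x rfl⟩)
  refine ⟨min (δ / 2) 1, by positivity, fun a => ?_⟩
  have hm1 : min (δ / 2) 1 ≤ δ / 2 := min_le_left _ _
  have hm2 : min (δ / 2) 1 ≤ 1 := min_le_right _ _
  by_cases ha : a ∈ Icc (-r₀ - 1) (r₀ + 1)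
  · obtain ⟨i, hi⟩ := hL a ha
    refine (measure_mono (fun z hz => hi ?_)).trans (hUμ i).le
    rw [Metric.mem_ball, Real.dist_eq, abs_lt]
    constructor <;> linarith [hz.1, hz.2]
  · have : μ (Icc a (a + min (δ / 2) 1)) ≤ μ {z : ℝ | r₀ ≤ |z|} := by
      refine measure_mono fun z hz => ?_
      rw [mem_ofPred_eq]
      by_contra hcon
      rw [not_le, abs_lt] at hcon
      apply ha
      constructor <;> linarith [hz.1, hz.2]
    rw [hsupp] at this
    exact this.trans bot_le

namespace FrontProf

variable {m p : ℝ → ℝ} {γ : ℝ}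

theorem nonconst (F : FrontProf m p γ) (hγ : 0 < γ) (a b : ℝ) (ha : 0 < a) (hab : a < b)
    (hb : b < γ) : ∃ x, 0 < p x ∧ m x ∈ Icc a b := by
  have hr : ∀ s, 0 < s → s < γ → ∃ x, m x = s := by
    intro s h0 h1
    obtain ⟨x1, hx1⟩ := (F.bot.eventually (lt_mem_nhds h1)).exists
    obtain ⟨x2, hx2⟩ := (F.top.eventually (gt_mem_nhds h0)).exists
    exact mem_range_of_exists_le_of_exists_ge F.cont ⟨x2, hx2.le⟩ ⟨x1, hx1.le⟩
  obtain ⟨x, hx⟩ := hr b (ha.trans hab) hb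
  obtain ⟨y, hy⟩ := hr a ha (hab.trans hb)
  have hxy : x < y := by
    by_contra hcon
    have := F.anti (not_lt.1 hcon)
    rw [hx, hy] at this; linarith
  obtain ⟨ξ, hξ, he⟩ := exists_hasDerivAt_eq_slope m (fun x => -(p x)) hxy F.cont.continuousOn
    (fun x _ => F.hd x)
  refine ⟨ξ, ?_, ?_⟩
  · have h1 : (m y - m x) / (y - x) < 0 := by
      apply div_neg_of_neg_of_pos <;> linarith
    linarith
  · constructor
    · rw [← hy]; exact F.anti hξ.2.le
    · rw [← hx]; exact F.anti hξ.1.le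

theorem pos_area (F : FrontProf m p γ) (hγ : 0 < γ) {g : ℝ → ℝ} (hg : Continuous g)
    (ν : Measure ℝ) [IsFiniteMeasure ν] (hs : MeasurePreserving (fun z : ℝ => -z) ν ν)
    (c : ℝ) (hc : 0 < c)
    (heq : ∀ x, c * p x = (∫ z, (m (x + z) - m x) ∂ν) + g (m x)) :
    0 < ∫ s in (0 : ℝ)..γ, g s := by
  obtain ⟨i1, e1⟩ := F.energy ν hs
  obtain ⟨i2, e2⟩ := F.integral_comp hg
  have hpc := F.hp
  have h1 : (fun x => c * p x * p x) =
      fun x => (∫ z, (m (x + z) - m x) ∂ν) * p x + g (m x) * p x := by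
    funext x; rw [heq]; ring
  have h2 : ∫ x, c * p x * p x = ∫ s in (0 : ℝ)..γ, g s := by
    rw [h1, integral_add i1 i2, e1, e2, zero_add]
  have i3 : Integrable (fun x => c * p x * p x) := by rw [h1]; exact i1.add i2
  have hnn : ∀ x, 0 ≤ c * p x * p x := fun x =>
    mul_nonneg (mul_nonneg hc.le (F.pnn x)) (F.pnn x)
  rw [← h2]
  refine lt_of_le_of_ne (integral_nonneg hnn) fun h0 => ?_
  have h3 := (integral_eq_zero_iff_of_nonneg hnn i3).1 h0.symm
  have h4 : (fun x => c * p x * p x) = fun _ => (0 : ℝ) :=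
    (Continuous.ae_eq_iff_eq volume (by fun_prop) continuous_const).1 h3
  obtain ⟨x, hx, -⟩ := F.nonconst hγ (γ / 3) (γ / 2) (by linarith) (by linarith) (by linarith)
  have := congrFun h4 x
  have : 0 < c * p x * p x := by positivity
  linarith

theorem osc (F : FrontProf m p γ) {g : ℝ → ℝ}
    (ν : Measure ℝ) [IsFiniteMeasure ν] (T : Set ℝ) (hT : MeasurableSet T)
    (c C h η : ℝ) (hh : 0 ≤ h) (hη : 0 ≤ η)
    (hC : ∀ s ∈ Icc 0 γ, ∀ t ∈ Icc 0 γ, |g s - g t| ≤ C * |s - t|)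
    (hb : C < (ν.restrict T).real univ)
    (hω : ∀ a, (ν.restrict T) (Icc a (a + h)) ≤ ENNReal.ofReal η)
    (heq : ∀ x, c * p x = (∫ z, (m (x + z) - m x) ∂ν) + g (m x)) (x : ℝ) :
    m x - m (x + h) ≤ γ * η / ((ν.restrict T).real univ - C) := by
  set b := (ν.restrict T).real univ with hbdef
  have hcont := F.cont
  have hbC : 0 < b - C := by linarith
  have hκ : 0 ≤ γ * η / (b - C) := div_nonneg (mul_nonneg F.γnn hη) hbC.le
  by_contra hcon
  push Not at hcon
  set q : ℝ → ℝ := fun x => m x - m (x + h) with hq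
  have hqc : Continuous q := by fun_prop
  have hq1 : Tendsto q atBot (𝓝 0) := by
    simpa using F.bot.sub (F.bot.comp (tendsto_atBot_add_const_right _ h tendsto_id))
  have hq2 : Tendsto q atTop (𝓝 0) := by
    simpa using F.top.sub (F.top.comp (tendsto_atTop_add_const_right _ h tendsto_id))
  have hqx : 0 < q x := lt_of_le_of_lt hκ hcon
  obtain ⟨x0, hx0⟩ := hqc.exists_forall_ge' (x₀ := x) (by
    rw [cocompact_eq_atBot_atTop, eventually_sup]
    exact ⟨(hq1.eventually (gt_mem_nhds hqx)).mono fun _ h => le_of_lt h,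
      (hq2.eventually (gt_mem_nhds hqx)).mono fun _ h => le_of_lt h⟩)
  have hd : HasDerivAt q (-(p x0) - -(p (x0 + h))) x0 :=
    (F.hd x0).sub ((F.hd (x0 + h)).comp_add_const x0 h)
  have hz : -(p x0) - -(p (x0 + h)) = 0 :=
    (show IsLocalMax q x0 from Filter.Eventually.of_forall hx0).hasDerivAt_eq_zero hd
  have hpp : p x0 = p (x0 + h) := by linarith
  have e1 := heq x0
  have e2 := heq (x0 + h)
  rw [← hpp] at e2
  have i1 := F.int_diff ν x0 x0
  have i2 := F.int_diff ν (x0 + h) (x0 + h)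
  have e3 : ∫ z, (q (x0 + z) - q x0) ∂ν = -(g (m x0) - g (m (x0 + h))) := by
    have : ∀ z, q (x0 + z) - q x0 = (m (x0 + z) - m x0) - (m (x0 + h + z) - m (x0 + h)) := by
      intro z
      have : x0 + z + h = x0 + h + z := by ring
      simp only [hq, this]; ring
    simp_rw [this]
    rw [integral_sub i1 i2]; linarith
  have iq : Integrable (fun z => q (x0 + z) - q x0) ν := by
    refine Integrable.of_bound (C := γ + γ) (by fun_prop : Continuous _).aestronglyMeasurable
      (ae_of_all _ fun z => ?_)
    refine (norm_sub_le _ _).trans (add_le_add (F.absdiff _ _) (F.absdiff _ _))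
  have e4 : ∫ z, (q (x0 + z) - q x0) ∂ν ≤ ∫ z in T, (q (x0 + z) - q x0) ∂ν := by
    have h1 := integral_add_compl hT iq
    have h2 : ∫ z in Tᶜ, (q (x0 + z) - q x0) ∂ν ≤ 0 :=
      integral_nonpos fun z => sub_nonpos.2 (hx0 _)
    linarith
  have iq2 : Integrable (fun z => q (x0 + z)) (ν.restrict T) := by
    refine Integrable.of_bound (C := γ) (by fun_prop : Continuous _).aestronglyMeasurable
      (ae_of_all _ fun z => F.absdiff _ _)
  rw [integral_sub iq2 (integrable_const _), integral_const, smul_eq_mul, ← hbdef] at e4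
  have e5 := F.equi (ν.restrict T) h η hh hη hω x0
  have e6 := hC _ (F.bd x0) _ (F.bd (x0 + h))
  have hq0 : 0 ≤ q x0 := hqx.le.trans (hx0 x)
  have e7 : |m x0 - m (x0 + h)| = q x0 := abs_of_nonneg hq0
  rw [e7] at e6
  have e8 := (abs_le.1 e6).2
  have e9 : (b - C) * q x0 ≤ γ * η := by
    have : ∫ z, q (x0 + z) ∂(ν.restrict T) ≤ γ * η := e5
    linarith
  have e10 : q x0 ≤ γ * η / (b - C) := by
    rw [le_div_iff₀ hbC]; linarith
  have := hx0 x
  have h11 : γ * η / (b - C) < q x := hcon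
  linarith

/-- The sliding average of a front profile. -/
theorem avg (F : FrontProf m p γ) (h : ℝ) (hh : 0 < h) :
    FrontProf (fun x => h⁻¹ * ∫ y in (0 : ℝ)..h, m (x + y)) (fun x => h⁻¹ * (m x - m (x + h))) γ ∧
    ∀ x, (h⁻¹ * ∫ y in (0 : ℝ)..h, m (x + y)) ∈ Icc (m (x + h)) (m x) := by
  have hc := F.cont
  have hint : ∀ x, IntervalIntegrable (fun y => m (x + y)) volume 0 h := fun x =>
    (by fun_prop : Continuous (fun y => m (x + y))).intervalIntegrable _ _
  have hmem : ∀ x, (h⁻¹ * ∫ y in (0 : ℝ)..h, m (x + y)) ∈ Icc (m (x + h)) (m x) := by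
    intro x
    have h1 : ∫ y in (0 : ℝ)..h, m (x + h) ≤ ∫ y in (0 : ℝ)..h, m (x + y) :=
      intervalIntegral.integral_mono_on hh.le (by simp) (hint x)
        fun y hy => F.anti (by linarith [hy.2])
    have h2 : ∫ y in (0 : ℝ)..h, m (x + y) ≤ ∫ y in (0 : ℝ)..h, m x :=
      intervalIntegral.integral_mono_on hh.le (hint x) (by simp)
        fun y hy => F.anti (by linarith [hy.1])
    simp only [intervalIntegral.integral_const, sub_zero, smul_eq_mul] at h1 h2
    constructor
    · rw [← div_eq_inv_mul, le_div_iff₀ hh]; linarith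
    · rw [← div_eq_inv_mul, div_le_iff₀ hh]; linarith
  refine ⟨⟨fun x => ?_, by fun_prop, fun x y hxy => ?_, fun x => ?_, ?_, ?_⟩, hmem⟩
  · have e : (fun x => h⁻¹ * ∫ y in (0 : ℝ)..h, m (x + y)) =
        fun x => h⁻¹ * ((∫ y in (0 : ℝ)..(x + h), m y) - ∫ y in (0 : ℝ)..x, m y) := by
      funext x
      rw [intervalIntegral.integral_comp_add_left (fun y => m y), add_zero,
        intervalIntegral.integral_interval_sub_left (hc.intervalIntegrable _ _)
          (hc.intervalIntegrable _ _)]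
    rw [e]
    have hG : ∀ s, HasDerivAt (fun s => ∫ t in (0 : ℝ)..s, m t) (m s) s := fun s =>
      intervalIntegral.integral_hasDerivAt_right (hc.intervalIntegrable _ _)
        (hc.stronglyMeasurableAtFilter _ _) hc.continuousAt
    have := (((hG (x + h)).comp_add_const x h).sub (hG x)).const_mul h⁻¹
    have e2 : -(h⁻¹ * (m x - m (x + h))) = h⁻¹ * (m (x + h) - m x) := by ring
    rw [e2]
    exact this
  · refine mul_le_mul_of_nonneg_left ?_ (inv_nonneg.2 hh.le)
    exact intervalIntegral.integral_mono_on hh.le (hint y) (hint x)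
      fun z _ => F.anti (by linarith)
  · exact ⟨(F.bd _).1.trans (hmem x).1, (hmem x).2.trans (F.bd x).2⟩
  · exact tendsto_of_tendsto_of_tendsto_of_le_of_le
      (F.bot.comp (tendsto_atBot_add_const_right _ h tendsto_id)) F.bot
      (fun x => (hmem x).1) (fun x => (hmem x).2)
  · exact tendsto_of_tendsto_of_tendsto_of_le_of_le
      (F.top.comp (tendsto_atTop_add_const_right _ h tendsto_id)) F.top
      (fun x => (hmem x).1) (fun x => (hmem x).2)

theorem caseA (F : FrontProf m p γ) {g : ℝ → ℝ} (hg : Continuous g)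
    (ν : Measure ℝ) [IsFiniteMeasure ν] (hs : MeasurePreserving (fun z : ℝ => -z) ν ν)
    (T : Set ℝ) (hT : MeasurableSet T)
    (c C h η : ℝ) (hc : 0 ≤ c) (hC0 : 0 ≤ C) (hh : 0 < h) (hη : 0 ≤ η)
    (hC : ∀ s ∈ Icc 0 γ, ∀ t ∈ Icc 0 γ, |g s - g t| ≤ C * |s - t|)
    (hb : C < (ν.restrict T).real univ)
    (hω : ∀ a, (ν.restrict T) (Icc a (a + h)) ≤ ENNReal.ofReal η)
    (heq : ∀ x, c * p x = (∫ z, (m (x + z) - m x) ∂ν) + g (m x)) :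
    ∫ s in (0 : ℝ)..γ, g s ≤
      (c * γ / h + C * (γ * η / ((ν.restrict T).real univ - C))) * γ := by
  set κ := γ * η / ((ν.restrict T).real univ - C) with hκ
  have hosc := F.osc ν T hT c C h η hh.le hη hC hb hω heq
  rw [← hκ] at hosc
  obtain ⟨G, hmem⟩ := F.avg h hh
  have hcont := F.cont
  have hpc := F.hp
  set M : ℝ → ℝ := fun x => h⁻¹ * ∫ y in (0 : ℝ)..h, m (x + y) with hM
  obtain ⟨i1, e1⟩ := G.energy ν hs
  obtain ⟨i2, e2⟩ := G.integral_comp hg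
  -- pointwise bound
  have hpt : ∀ x, (∫ z, (M (x + z) - M x) ∂ν) + g (M x) ≤ c * γ / h + C * κ := by
    intro x
    have hsw : ∫ z, (M (x + z) - M x) ∂ν =
        h⁻¹ * ∫ y in (0 : ℝ)..h, ∫ z, (m (x + y + z) - m (x + y)) ∂ν := by
      have h1 : ∀ z, M (x + z) - M x =
          h⁻¹ * ∫ y in (0 : ℝ)..h, (m (x + y + z) - m (x + y)) := by
        intro z
        have : ∀ y, x + y + z = x + z + y := fun y => by ring
        simp only [hM, this]
        rw [intervalIntegral.integral_sub
          ((by fun_prop : Continuous (fun y => m (x + z + y))).intervalIntegrable _ _)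
          ((by fun_prop : Continuous (fun y => m (x + y))).intervalIntegrable _ _)]
        ring
      simp_rw [h1]
      rw [integral_const_mul]
      congr 1
      simp_rw [intervalIntegral.integral_of_le hh.le]
      rw [integral_integral_swap]
      refine Integrable.of_bound (C := γ) ?_ (ae_of_all _ fun q => F.absdiff _ _)
      exact (by fun_prop : Continuous (fun q : ℝ × ℝ =>
        m (x + q.2 + q.1) - m (x + q.2))).aestronglyMeasurable
    have h2 : ∀ y, ∫ z, (m (x + y + z) - m (x + y)) ∂ν = c * p (x + y) - g (m (x + y)) := by
      intro y; rw [heq]; ring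
    rw [hsw]
    simp_rw [h2]
    have cg : Continuous (fun y => g (m (x + y))) := by fun_prop
    have cp : Continuous (fun y => p (x + y)) := by fun_prop
    rw [intervalIntegral.integral_sub ((cp.intervalIntegrable _ _).const_mul c)
      (cg.intervalIntegrable _ _), intervalIntegral.integral_const_mul]
    have h3 : ∫ y in (0 : ℝ)..h, p (x + y) = m x - m (x + h) := by
      rw [intervalIntegral.integral_comp_add_left (fun y => p y), add_zero,
        intervalIntegral.integral_eq_sub_of_hasDerivAt (f := fun x => -(m x))
          (fun x _ => F.hdn x) (hpc.intervalIntegrable _ _)]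
      ring
    have h4 : ∫ y in (0 : ℝ)..h, (g (M x) - C * κ) ≤ ∫ y in (0 : ℝ)..h, g (m (x + y)) := by
      refine intervalIntegral.integral_mono_on hh.le (by simp) (cg.intervalIntegrable _ _) ?_
      intro y hy
      have h5 := hC _ (G.bd x) _ (F.bd (x + y))
      have h6 : |M x - m (x + y)| ≤ κ := by
        have a1 := (hmem x).1
        have a2 := (hmem x).2
        have a3 := F.anti (show x + y ≤ x + h by linarith [hy.2])
        have a4 := F.anti (show x ≤ x + y by linarith [hy.1])
        have a5 := hosc x
        rw [abs_le]
        constructor <;> simp only [hM] <;> linarith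
      have h7 := mul_le_mul_of_nonneg_left h6 hC0
      have h8 := (abs_le.1 h5).2
      linarith
    rw [intervalIntegral.integral_const, sub_zero, smul_eq_mul] at h4
    have h9 : m x - m (x + h) ≤ γ := (le_abs_self _).trans (F.absdiff _ _)
    rw [h3, ← div_eq_inv_mul]
    have h10 : (c * (m x - m (x + h)) - ∫ y in (0 : ℝ)..h, g (m (x + y))) / h ≤
        c * γ / h + C * κ - g (M x) := by
      rw [div_le_iff₀ hh]
      have : (c * γ / h + C * κ - g (M x)) * h = c * γ + C * κ * h - g (M x) * h := by
        field_simp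
      rw [this]
      have := mul_le_mul_of_nonneg_left h9 hc
      linarith
    linarith
  have h1 : ∫ x, ((∫ z, (M (x + z) - M x) ∂ν) * (h⁻¹ * (m x - m (x + h))) +
      g (M x) * (h⁻¹ * (m x - m (x + h)))) ≤
      ∫ x, (c * γ / h + C * κ) * (h⁻¹ * (m x - m (x + h))) := by
    refine integral_mono (i1.add i2) (G.intP.const_mul _) fun x => ?_
    have := mul_le_mul_of_nonneg_right (hpt x) (G.pnn x)
    simp only at this ⊢
    linarith
  rw [integral_add i1 i2, e1, e2, integral_const_mul, G.intP_eq, zero_add] at h1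
  exact h1

end FrontProf

/-- Running maximum of `t ↦ b t - g t` over `[0,s]`. -/
noncomputable def runMax (g : ℝ → ℝ) (b s : ℝ) : ℝ :=
  sSup ((fun t => b * (t * s) - g (t * s)) '' Icc (0 : ℝ) 1)

theorem runMax_cont {g : ℝ → ℝ} (hg : Continuous g) (b : ℝ) : Continuous (runMax g b) := by
  refine IsCompact.continuous_sSup (f := fun s t => b * (t * s) - g (t * s)) isCompact_Icc ?_
  simp only [Function.HasUncurry.uncurry, id]
  fun_prop

theorem le_runMax {g : ℝ → ℝ} (hg : Continuous g) (b s t : ℝ) (h0 : 0 ≤ t) (h1 : t ≤ s) :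
    b * t - g t ≤ runMax g b s := by
  have hbdd : BddAbove ((fun t => b * (t * s) - g (t * s)) '' Icc (0 : ℝ) 1) :=
    (isCompact_Icc.image (by fun_prop)).bddAbove
  apply le_csSup hbdd
  rcases eq_or_lt_of_le (h0.trans h1) with hs | hs
  · refine ⟨0, by simp, ?_⟩
    have : t = 0 := by linarith
    simp [this]
  · refine ⟨t / s, ⟨by positivity, (div_le_one hs).2 h1⟩, ?_⟩
    simp only
    rw [div_mul_cancel₀ _ hs.ne']

theorem runMax_le {g : ℝ → ℝ} (b s B : ℝ) (hs : 0 ≤ s)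
    (h : ∀ t, 0 ≤ t → t ≤ s → b * t - g t ≤ B) : runMax g b s ≤ B := by
  apply csSup_le ((nonempty_Icc.2 zero_le_one).image _)
  rintro _ ⟨t, ht, rfl⟩
  exact h _ (mul_nonneg ht.1 hs) (mul_le_of_le_one_left hs ht.2)

/-- The excess functional. -/
noncomputable def excess (g : ℝ → ℝ) (γ b : ℝ) : ℝ :=
  b * (γ ^ 2 / 2) - ∫ s in (0 : ℝ)..γ, runMax g b s

theorem excess_mono {g : ℝ → ℝ} (hg : Continuous g) (γ b b' : ℝ) (hγ : 0 ≤ γ) (hb : b ≤ b') :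
    excess g γ b ≤ excess g γ b' := by
  have h1 : ∫ s in (0 : ℝ)..γ, runMax g b' s ≤
      ∫ s in (0 : ℝ)..γ, (runMax g b s + (b' - b) * s) := by
    have hc := runMax_cont hg b
    refine intervalIntegral.integral_mono_on hγ ((runMax_cont hg b').intervalIntegrable _ _)
      ((by fun_prop : Continuous (fun s => runMax g b s + (b' - b) * s)).intervalIntegrable _ _) ?_
    intro s hs
    refine runMax_le _ _ _ hs.1 fun t h0 h1 => ?_
    have := le_runMax hg b s t h0 h1
    have := mul_le_mul_of_nonneg_left h1 (sub_nonneg.2 hb)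
    linarith
  rw [intervalIntegral.integral_add ((runMax_cont hg b).intervalIntegrable _ _)
    ((by fun_prop : Continuous (fun s => (b' - b) * s)).intervalIntegrable _ _),
    intervalIntegral.integral_const_mul, integral_id] at h1
  unfold excess
  linarith

namespace FrontProf

variable {m p : ℝ → ℝ} {γ : ℝ}

theorem D_eq (F : FrontProf m p γ) (ν : Measure ℝ) [IsFiniteMeasure ν] (x : ℝ) :
    ∫ z, (m (x + z) - m x) ∂ν = (∫ z, m (x + z) ∂ν) - ν.real univ * m x := by
  rw [integral_sub (F.int_m ν x) (integrable_const _), integral_const, smul_eq_mul]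

theorem excess_eq (F : FrontProf m p γ) {g : ℝ → ℝ} (hg : Continuous g)
    (ν : Measure ℝ) [IsFiniteMeasure ν] (hs : MeasurePreserving (fun z : ℝ => -z) ν ν) :
    Integrable (fun x => ((∫ z, m (x + z) ∂ν) - runMax g (ν.real univ) (m x)) * p x) ∧
    ∫ x, ((∫ z, m (x + z) ∂ν) - runMax g (ν.real univ) (m x)) * p x =
      excess g γ (ν.real univ) := by
  obtain ⟨i1, e1⟩ := F.energy ν hs
  have hc := runMax_cont hg (ν.real univ)
  obtain ⟨i2, e2⟩ := F.integral_comp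
    (φ := fun s => ν.real univ * s - runMax g (ν.real univ) s) (by fun_prop)
  have h : (fun x => ((∫ z, m (x + z) ∂ν) - runMax g (ν.real univ) (m x)) * p x) =
      fun x => (∫ z, (m (x + z) - m x) ∂ν) * p x +
        (ν.real univ * m x - runMax g (ν.real univ) (m x)) * p x := by
    funext x; rw [F.D_eq]; ring
  rw [h]
  refine ⟨i1.add i2, ?_⟩
  rw [integral_add i1 i2, e1, e2, intervalIntegral.integral_sub
    ((by fun_prop : Continuous (fun s => ν.real univ * s)).intervalIntegrable _ _)
    (hc.intervalIntegrable _ _), intervalIntegral.integral_const_mul, integral_id]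
  unfold excess
  ring

theorem K_anti (F : FrontProf m p γ) (ν : Measure ℝ) [IsFiniteMeasure ν] :
    Antitone (fun x => ∫ z, m (x + z) ∂ν) := fun x y hxy =>
  integral_mono (F.int_m ν y) (F.int_m ν x) fun z => F.anti (by linarith)

theorem K_ge (F : FrontProf m p γ) {g : ℝ → ℝ} (hg0 : g 0 = 0)
    (ν : Measure ℝ) [IsFiniteMeasure ν] (c : ℝ) (hc : 0 ≤ c)
    (heq : ∀ x, c * p x = (∫ z, (m (x + z) - m x) ∂ν) + g (m x)) (x : ℝ) :
    runMax g (ν.real univ) (m x) ≤ ∫ z, m (x + z) ∂ν := by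
  refine runMax_le _ _ _ (F.bd x).1 fun t h0 h1 => ?_
  rcases eq_or_lt_of_le h0 with h | h
  · rw [← h, hg0]; simp only [mul_zero, sub_zero]
    exact integral_nonneg fun z => (F.bd _).1
  · obtain ⟨x2, hx2⟩ := ((F.top.eventually (gt_mem_nhds h)).and (eventually_ge_atTop x)).exists
    obtain ⟨y, hy, hyt⟩ := intermediate_value_Icc' hx2.2 F.cont.continuousOn
      (show t ∈ Icc (m x2) (m x) from ⟨hx2.1.le, h1⟩)
    have h2 := F.K_anti ν hy.1
    have h3 := heq y
    rw [F.D_eq, hyt] at h3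
    have h4 := mul_nonneg hc (F.pnn y)
    simp only at h2
    linarith

theorem excess_pos (F : FrontProf m p γ) (hγ : 0 < γ) {g : ℝ → ℝ} (hg : Continuous g)
    (hg0 : g 0 = 0) (ν : Measure ℝ) [IsFiniteMeasure ν]
    (hs : MeasurePreserving (fun z : ℝ => -z) ν ν) (c : ℝ) (hc : 0 < c)
    (heq : ∀ x, c * p x = (∫ z, (m (x + z) - m x) ∂ν) + g (m x))
    (s₀ : ℝ) (hs0 : 0 < s₀) (hga : AntitoneOn g (Icc 0 s₀)) :
    0 < excess g γ (ν.real univ) := by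
  obtain ⟨i1, e1⟩ := F.excess_eq hg ν hs
  have hmc := F.cont
  have hpc := F.hp
  have hrc := runMax_cont hg (ν.real univ)
  have hnn : ∀ x, 0 ≤ ((∫ z, m (x + z) ∂ν) - runMax g (ν.real univ) (m x)) * p x := fun x =>
    mul_nonneg (sub_nonneg.2 (F.K_ge hg0 ν c hc.le heq x)) (F.pnn x)
  have hK : ∀ x, ∫ z, m (x + z) ∂ν = c * p x - g (m x) + ν.real univ * m x := by
    intro x
    have := heq x
    rw [F.D_eq] at this
    linarith
  rw [← e1]
  refine lt_of_le_of_ne (integral_nonneg hnn) fun h0 => ?_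
  have h3 := (integral_eq_zero_iff_of_nonneg hnn i1).1 h0.symm
  have h4 : (fun x => ((∫ z, m (x + z) ∂ν) - runMax g (ν.real univ) (m x)) * p x) =
      fun _ => (0 : ℝ) := by
    refine (Continuous.ae_eq_iff_eq volume ?_ continuous_const).1 h3
    simp_rw [hK]
    fun_prop
  have hmin1 : min s₀ γ ≤ s₀ := min_le_left _ _
  have hmin2 : min s₀ γ ≤ γ := min_le_right _ _
  have hmin : 0 < min s₀ γ := lt_min hs0 hγ
  obtain ⟨x, hx, hxm⟩ := F.nonconst hγ (min s₀ γ / 3) (min s₀ γ / 2) (by linarith) (by linarith)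
    (by linarith)
  have h5 := congrFun h4 x
  have h6 : runMax g (ν.real univ) (m x) ≤ ν.real univ * m x - g (m x) := by
    refine runMax_le _ _ _ (F.bd x).1 fun t a b => ?_
    have h7 := hga ⟨a, by linarith [hxm.2]⟩ ⟨(F.bd x).1, by linarith [hxm.2]⟩ b
    have h8 := mul_le_mul_of_nonneg_left b (measureReal_nonneg (μ := ν) (s := univ))
    linarith
  have h9 : 0 < c * p x := mul_pos hc hx
  have h10 : 0 < (∫ z, m (x + z) ∂ν) - runMax g (ν.real univ) (m x) := by
    rw [hK]; linarith
  have := mul_pos h10 hx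
  linarith

theorem excess_le (F : FrontProf m p γ) {g : ℝ → ℝ} (hg : Continuous g)
    (ν : Measure ℝ) [IsFiniteMeasure ν]
    (hs : MeasurePreserving (fun z : ℝ => -z) ν ν) (c h η : ℝ) (hc : 0 ≤ c) (hh : 0 < h)
    (hη : 0 ≤ η)
    (hω : ∀ a, ν (Icc a (a + h)) ≤ ENNReal.ofReal η)
    (heq : ∀ x, c * p x = (∫ z, (m (x + z) - m x) ∂ν) + g (m x)) :
    excess g γ (ν.real univ) ≤ (γ * η + c * (γ / h)) * γ := by
  obtain ⟨i1, e1⟩ := F.excess_eq hg ν hs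
  rw [← e1]
  have h1 : ∀ x, (∫ z, m (x + z) ∂ν) - runMax g (ν.real univ) (m x) ≤ γ * η + c * (γ / h) := by
    intro x
    obtain ⟨ξ, hξ, he⟩ := exists_hasDerivAt_eq_slope m (fun x => -(p x))
      (show x < x + h by linarith) F.cont.continuousOn (fun x _ => F.hd x)
    have h2 : p ξ ≤ γ / h := by
      have h3 : p ξ = (m x - m (x + h)) / h := by
        have : p ξ = -((m (x + h) - m x) / (x + h - x)) := by rw [← he]; ring
        rw [this]; rw [add_sub_cancel_left]; ring
      rw [h3]
      exact div_le_div_of_nonneg_right ((le_abs_self _).trans (F.absdiff _ _)) hh.le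
    have h4 := F.equi ν h η hh.le hη hω x
    have h5 : ∀ z, x + z + h = x + h + z := fun z => by ring
    simp_rw [h5] at h4
    rw [integral_sub (F.int_m ν x) (F.int_m ν (x + h))] at h4
    have h6 := F.K_anti ν hξ.2.le
    simp only at h6
    have h7 := heq ξ
    rw [F.D_eq] at h7
    have h8 := le_runMax hg (ν.real univ) (m x) (m ξ) (F.bd ξ).1 (F.anti hξ.1.le)
    have h9 := mul_le_mul_of_nonneg_left h2 hc
    linarith
  calc _ ≤ ∫ x, (γ * η + c * (γ / h)) * p x :=
        integral_mono i1 (F.intP.const_mul _) fun x =>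
          mul_le_mul_of_nonneg_right (h1 x) (F.pnn x)
    _ = _ := by rw [integral_const_mul, F.intP_eq]

end FrontProf

namespace LevyMeasure

theorem tail_lt_top {lam : Measure ℝ} (hlam : LevyMeasure lam) (δ : ℝ) (hδ : 0 < δ) :
    lam {z : ℝ | δ < |z|} < ⊤ := by
  have hpos : 0 < min 1 (δ ^ 2) := by positivity
  have h1 := meas_ge_le_lintegral_div (μ := lam)
    (f := fun z : ℝ => ENNReal.ofReal (min 1 (z ^ 2))) (by fun_prop)
    (ε := ENNReal.ofReal (min 1 (δ ^ 2))) (ENNReal.ofReal_pos.2 hpos).ne' ENNReal.ofReal_ne_top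
  refine (measure_mono ?_).trans_lt (h1.trans_lt
    (ENNReal.div_lt_top hlam.moment.ne (ENNReal.ofReal_pos.2 hpos).ne'))
  intro z hz
  refine ENNReal.ofReal_le_ofReal (min_le_min le_rfl ?_)
  rw [← sq_abs z]
  exact pow_le_pow_left₀ hδ.le (le_of_lt hz) 2

theorem meas_tail (δ : ℝ) : MeasurableSet {z : ℝ | δ < |z|} :=
  measurableSet_lt measurable_const (by fun_prop)

theorem tail_symm {lam : Measure ℝ} (hlam : LevyMeasure lam) (δ : ℝ) :
    MeasurePreserving (fun z : ℝ => -z) (lam.restrict {z : ℝ | δ < |z|})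
      (lam.restrict {z : ℝ | δ < |z|}) := by
  have h : MeasurePreserving (fun z : ℝ => -z) lam lam := ⟨measurable_neg, hlam.symm⟩
  have := h.restrict_preimage (meas_tail δ)
  simpa [preimage] using this

end LevyMeasure

theorem exists_lip {g : ℝ → ℝ} (hg : ContDiff ℝ 1 g) (γ : ℝ) :
    ∃ C, 0 ≤ C ∧ ∀ s ∈ Icc 0 γ, ∀ t ∈ Icc 0 γ, |g s - g t| ≤ C * |s - t| := by
  have hc : Continuous (deriv g) := hg.continuous_deriv le_rfl
  obtain ⟨B, hB⟩ := (isCompact_Icc (a := (0 : ℝ)) (b := γ)).exists_bound_of_continuousOn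
    hc.continuousOn
  refine ⟨max B 0, le_max_right _ _, fun s hs t ht => ?_⟩
  exact (convex_Icc 0 γ).norm_image_sub_le_of_norm_deriv_le
    (fun x _ => (hg.differentiable one_ne_zero) x) (fun x hx => (hB x hx).trans (le_max_left _ _))
    ht hs

theorem exists_anti {g : ℝ → ℝ} (hg : ContDiff ℝ 1 g) (hdg0 : deriv g 0 < 0) :
    ∃ s₀ > 0, AntitoneOn g (Icc 0 s₀) := by
  have hc : Continuous (deriv g) := hg.continuous_deriv le_rfl
  obtain ⟨r, hr, hb⟩ := Metric.eventually_nhds_iff.1 ((hc.tendsto 0).eventually (gt_mem_nhds hdg0))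
  refine ⟨r / 2, by positivity, antitoneOn_of_deriv_nonpos (convex_Icc _ _)
    hg.continuous.continuousOn (hg.differentiable one_ne_zero).differentiableOn ?_⟩
  intro x hx
  rw [interior_Icc] at hx
  refine (hb ?_).le
  rw [Real.dist_eq, sub_zero, abs_of_pos hx.1]
  linarith [hx.2]

/-- The hypotheses of the key lemma are contradictory. -/
theorem key_contradiction
    (lam : Measure ℝ) (hlam : LevyMeasure lam)
    (r₀ : ℝ) (hsupp : lam {z : ℝ | r₀ ≤ |z|} = 0)
    (g : ℝ → ℝ) (hg : ContDiff ℝ 1 g) (hg0 : g 0 = 0) (hdg0 : deriv g 0 < 0)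
    (γ : ℝ) (hγ : 0 < γ)
    (ε : ℕ → ℝ) (hε : ∀ n, 0 < ε n) (hεlim : Tendsto ε atTop (𝓝 (0 : ℝ)))
    (c : ℕ → ℝ) (m : ℕ → ℝ → ℝ)
    (hc : ∀ n, 0 < c n)
    (hm : ∀ n, ContDiff ℝ 2 (m n))
    (hma : ∀ n, Antitone (m n))
    (hmb : ∀ n x, m n x ∈ Set.Icc 0 γ)
    (heq : ∀ n x, -(c n) * deriv (m n) x
      = (∫ z in {z : ℝ | ε n < |z|}, (m n (x + z) - m n x) ∂lam) + g (m n x))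
    (hlb : ∀ n, Tendsto (m n) atBot (𝓝 γ))
    (hlt : ∀ n, Tendsto (m n) atTop (𝓝 (0 : ℝ)))
    (hclim : Tendsto c atTop (𝓝 (0 : ℝ))) : False := by
  have F : ∀ n, FrontProf (m n) (fun x => -(deriv (m n) x)) γ := fun n =>
    { hd := fun x => by
        simpa using ((hm n).differentiable two_ne_zero x).hasDerivAt
      hp := ((hm n).continuous_deriv (by norm_num)).neg
      anti := hma n
      bd := hmb n
      bot := hlb n
      top := hlt n }
  have heq' : ∀ n x, c n * (-(deriv (m n) x))
      = (∫ z, (m n (x + z) - m n x) ∂(lam.restrict {z : ℝ | ε n < |z|})) + g (m n x) := by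
    intro n x; rw [← heq]; ring
  have hfin : ∀ δ, 0 < δ → IsFiniteMeasure (lam.restrict {z : ℝ | δ < |z|}) := fun δ hδ =>
    ⟨by rw [Measure.restrict_apply_univ]; exact hlam.tail_lt_top δ hδ⟩
  have hfn : ∀ n, IsFiniteMeasure (lam.restrict {z : ℝ | ε n < |z|}) := fun n => hfin _ (hε n)
  have hsymm := fun n => hlam.tail_symm (ε n)
  have hgc := hg.continuous
  obtain ⟨C, hC0, hC⟩ := exists_lip hg γ
  obtain ⟨s₀, hs0, hga⟩ := exists_anti hg hdg0
  by_cases hcase : ∃ δ > 0, ENNReal.ofReal C < lam {z : ℝ | δ < |z|}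
  · -- large mass: equicontinuity
    obtain ⟨δ, hδ, hbig⟩ := hcase
    have hμ := hfin δ hδ
    have hS := (F 0).pos_area hγ hgc _ (hsymm 0) (c 0) (hc 0) (heq' 0)
    set S := ∫ s in (0 : ℝ)..γ, g s with hSdef
    set b := (lam.restrict {z : ℝ | δ < |z|}).real univ with hb
    have hbC : C < b := by
      rw [hb, measureReal_def, Measure.restrict_apply_univ]
      exact (ENNReal.ofReal_lt_iff_lt_toReal hC0 (hlam.tail_lt_top δ hδ).ne).1 hbig
    have hbC' : 0 < b - C := by linarith
    -- choose η
    obtain ⟨η, hη, hηS⟩ : ∃ η > 0, C * (γ * η / (b - C)) * γ ≤ S / 4 := by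
      refine ⟨S * (b - C) / (4 * (C + 1) * γ ^ 2), by positivity, ?_⟩
      have : C * (γ * (S * (b - C) / (4 * (C + 1) * γ ^ 2)) / (b - C)) * γ
          = (S / 4) * (C / (C + 1)) := by
        field_simp
      rw [this]
      exact mul_le_of_le_one_right (by positivity) ((div_le_one (by positivity)).2 (by linarith))
    obtain ⟨h, hh, hω⟩ := diffuse_unif (lam.restrict {z : ℝ | δ < |z|}) (fun x => by
        rw [Measure.restrict_apply (measurableSet_singleton x)]
        by_cases hx : x = 0
        · have : ({x} : Set ℝ) ∩ {z : ℝ | δ < |z|} = ∅ := by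
            ext z
            simp only [mem_inter_iff, mem_singleton_iff, mem_ofPred_eq, mem_empty_iff_false,
              iff_false, not_and, not_lt]
            rintro rfl
            rw [hx, abs_zero]; exact hδ.le
          rw [this, measure_empty]
        · exact measure_mono_null inter_subset_left (hlam.diffuse x hx)) r₀
      (le_antisymm ((Measure.restrict_apply_le _ _).trans hsupp.le) bot_le) η hη
    have e1 : ∀ᶠ n in atTop, ε n < δ := hεlim.eventually (gt_mem_nhds hδ)
    have e2 : ∀ᶠ n in atTop, c n < S * h / (4 * γ ^ 2) :=
      hclim.eventually (gt_mem_nhds (by positivity))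
    obtain ⟨N, hN1, hN2⟩ := (e1.and e2).exists
    have hr : (lam.restrict {z : ℝ | ε N < |z|}).restrict {z : ℝ | δ < |z|} =
        lam.restrict {z : ℝ | δ < |z|} := by
      rw [Measure.restrict_restrict (LevyMeasure.meas_tail δ)]
      congr 1
      exact inter_eq_left.2 fun z hz => lt_trans hN1 hz
    have key := (F N).caseA hgc _ (hsymm N) {z : ℝ | δ < |z|} (LevyMeasure.meas_tail δ)
      (c N) C h η (hc N).le hC0 hh hη.le hC (by rw [hr]; exact hbC) (by rw [hr]; exact hω) (heq' N)
    rw [hr, ← hb, ← hSdef, add_mul] at key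
    have : c N * γ / h * γ ≤ S / 4 := by
      rw [lt_div_iff₀ (by positivity)] at hN2
      have : c N * γ / h * γ = c N * γ ^ 2 / h := by ring
      rw [this, div_le_iff₀ hh]
      linarith
    linarith
  · -- small total mass: excess functional
    push Not at hcase
    have hfin0 : lam {(0 : ℝ)}ᶜ < ⊤ := by
      have hun : ({(0 : ℝ)}ᶜ : Set ℝ) = ⋃ k : ℕ, {z : ℝ | 1 / ((k : ℝ) + 1) < |z|} := by
        ext z
        simp only [mem_compl_iff, mem_singleton_iff, mem_iUnion, mem_ofPred_eq]
        constructor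
        · intro hz
          exact exists_nat_one_div_lt (abs_pos.2 hz)
        · rintro ⟨k, hk⟩ rfl
          rw [abs_zero] at hk
          exact absurd hk (not_lt.2 (by positivity))
      have hmono : Monotone (fun k : ℕ => {z : ℝ | 1 / ((k : ℝ) + 1) < |z|}) := by
        intro i j hij z hz
        have hz1 : 1 / ((i : ℝ) + 1) < |z| := hz
        have hz2 : 1 / ((j : ℝ) + 1) < |z| := lt_of_le_of_lt (Nat.one_div_le_one_div hij) hz1
        exact hz2
      rw [hun, hmono.measure_iUnion]
      exact (iSup_le fun k => hcase _ (by positivity)).trans_lt ENNReal.ofReal_lt_top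
    have hμ : IsFiniteMeasure (lam.restrict {(0 : ℝ)}ᶜ) :=
      ⟨by rw [Measure.restrict_apply_univ]; exact hfin0⟩
    have hI := (F 0).excess_pos hγ hgc hg0 _ (hsymm 0) (c 0) (hc 0) (heq' 0) s₀ hs0 hga
    set I := excess g γ ((lam.restrict {z : ℝ | ε 0 < |z|}).real univ) with hIdef
    obtain ⟨h, hh, hω⟩ := diffuse_unif (lam.restrict {(0 : ℝ)}ᶜ) (fun x => by
        rw [Measure.restrict_apply (measurableSet_singleton x)]
        by_cases hx : x = 0
        · rw [hx, inter_compl_self, measure_empty]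
        · exact measure_mono_null inter_subset_left (hlam.diffuse x hx)) r₀
      (le_antisymm ((Measure.restrict_apply_le _ _).trans hsupp.le) bot_le) (I / (4 * γ ^ 2))
      (by positivity)
    have e1 : ∀ᶠ n in atTop, ε n < ε 0 := hεlim.eventually (gt_mem_nhds (hε 0))
    have e2 : ∀ᶠ n in atTop, c n < I * h / (4 * γ ^ 2) :=
      hclim.eventually (gt_mem_nhds (by positivity))
    obtain ⟨N, hN1, hN2⟩ := (e1.and e2).exists
    have hle : lam.restrict {z : ℝ | ε N < |z|} ≤ lam.restrict {(0 : ℝ)}ᶜ := by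
      refine Measure.restrict_mono (fun z hz hz0 => ?_) le_rfl
      rw [mem_singleton_iff] at hz0
      have hz' : ε N < |z| := hz
      rw [hz0, abs_zero] at hz'
      exact absurd hz' (not_lt.2 (hε N).le)
    have key := (F N).excess_le hgc _ (hsymm N) (c N) h (I / (4 * γ ^ 2)) (hc N).le hh
      (by positivity) (fun a => (hle _).trans (hω a)) (heq' N)
    have hbb : (lam.restrict {z : ℝ | ε 0 < |z|}).real univ ≤
        (lam.restrict {z : ℝ | ε N < |z|}).real univ := by
      rw [measureReal_def, measureReal_def, Measure.restrict_apply_univ,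
        Measure.restrict_apply_univ]
      exact ENNReal.toReal_mono (hlam.tail_lt_top _ (hε N)).ne
        (measure_mono fun z hz => lt_trans hN1 hz)
    have hmono := excess_mono hgc γ _ _ hγ.le hbb
    rw [← hIdef] at hmono
    have h1 : (γ * (I / (4 * γ ^ 2)) + c N * (γ / h)) * γ = I / 4 + c N * γ ^ 2 / h := by
      field_simp
    rw [h1] at key
    have : c N * γ ^ 2 / h ≤ I / 4 := by
      rw [lt_div_iff₀ (by positivity)] at hN2
      rw [div_le_iff₀ hh]
      linarith
    linarith

/-- key lemma for compactly supported unbounded measures (Lemma 3.1). -/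
theorem key_lemma_bounded_support
    (lam : Measure ℝ) (hlam : LevyMeasure lam) (hinf : lam Set.univ = ⊤)
    (r₀ : ℝ) (hr₀ : 0 < r₀) (hsupp : lam {z : ℝ | r₀ ≤ |z|} = 0)
    (g : ℝ → ℝ) (hg : ContDiff ℝ 1 g) (hg0 : g 0 = 0) (hdg0 : deriv g 0 < 0)
    (θ γ : ℝ) (hθ : 0 < θ) (hθγ : θ < γ)
    (hgθ : g θ = 0) (hgγ : g γ = 0)
    (hgneg : ∀ s ∈ Set.Ioo (0 : ℝ) θ, g s < 0)
    (hgpos : ∀ s ∈ Set.Ioo θ γ, 0 < g s)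
    (ε : ℕ → ℝ) (hε : ∀ n, 0 < ε n) (hεlim : Tendsto ε atTop (𝓝 (0 : ℝ)))
    (c : ℕ → ℝ) (m : ℕ → ℝ → ℝ)
    (hc : ∀ n, 0 < c n)
    (hm : ∀ n, ContDiff ℝ 2 (m n))
    (hma : ∀ n, Antitone (m n))
    (hmb : ∀ n x, m n x ∈ Set.Icc 0 γ)
    (heq : ∀ n x, -(c n) * deriv (m n) x
      = (∫ z in {z : ℝ | ε n < |z|}, (m n (x + z) - m n x) ∂lam) + g (m n x))
    (hlb : ∀ n, Tendsto (m n) atBot (𝓝 γ))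
    (hlt : ∀ n, Tendsto (m n) atTop (𝓝 (0 : ℝ)))
    (hclim : Tendsto c atTop (𝓝 (0 : ℝ))) :
    ∃ mbar : ℝ → ℝ,
      Continuous mbar ∧
      (∀ x, 0 < mbar x) ∧
      Antitone mbar ∧
      Tendsto mbar atBot (𝓝 γ) ∧
      Tendsto mbar atTop (𝓝 (0 : ℝ)) ∧
      (∀ᵐ x ∂(volume : Measure ℝ),
        ∃ L : ℝ, HasPV lam mbar x L ∧ L + g (mbar x) = 0) := by
  exact (key_contradiction lam hlam r₀ hsupp g hg hg0 hdg0 γ (hθ.trans hθγ) ε hε hεlim c m hc hm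
    hma hmb heq hlb hlt hclim).elim
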